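/- Let Ω = [0,1] with Lebesgue measure ℙ, let K = { f ∈ L_1([0,1]) : 0 ≤ f ≤ 2 a.e. and E[f] = 1 }, and define F : K → K by F(f)(ω) = min{2, 2f(2ω)} for 0 ≤ ω ≤ 1/2 and F(f)(ω) = max{0, 2f(2ω−1) − 2} for 1/2 < ω ≤ 1. Then F maps K into K and is an isometry on K: ‖F(f) − F(g)‖_{L_1} = ‖f − g‖_{L_1} for all f, g ∈ K. -/

import Mathlib

open MeasureTheory Filter Topology

/-- Lebesgue measure restricted to `[0,1]`. -/
noncomputable def μ01 : Measure ℝ := volume.restrict (Set.Icc (0 : ℝ) 1)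

/-- Membership in Alspach's set `K = {f ∈ L₁([0,1]) : 0 ≤ f ≤ 2 a.e., E[f] = 1}`. -/
def memK (f : ℝ → ℝ) : Prop :=
  Integrable f μ01 ∧ (∀ᵐ ω ∂μ01, 0 ≤ f ω ∧ f ω ≤ 2) ∧ ∫ ω, f ω ∂μ01 = 1

/-- Alspach's map `F(f)(ω) = min{2, 2f(2ω)}` for `ω ≤ 1/2` and
`F(f)(ω) = max{0, 2f(2ω−1) − 2}` for `ω > 1/2`. -/
noncomputable def alspachF (f : ℝ → ℝ) (ω : ℝ) : ℝ :=
  if ω ≤ 1 / 2 then min 2 (2 * f (2 * ω)) else max 0 (2 * f (2 * ω - 1) - 2)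

/-- The function on `[0,1]` obtained by compressing `u` into `[0,1/2]` and `v` into `(1/2,1]`. -/
noncomputable def glueHalves (u v : ℝ → ℝ) (ω : ℝ) : ℝ :=
  if ω ≤ 1 / 2 then u (2 * ω) else v (2 * ω - 1)

theorem integrable_μ01_iff {f : ℝ → ℝ} :
    Integrable f μ01 ↔ IntervalIntegrable f volume 0 1 := by
  rw [intervalIntegrable_iff_integrableOn_Icc_of_le zero_le_one]
  rfl

theorem integral_μ01_eq (f : ℝ → ℝ) : ∫ ω, f ω ∂μ01 = ∫ ω in (0 : ℝ)..1, f ω := by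
  rw [intervalIntegral.integral_of_le zero_le_one, ← integral_Icc_eq_integral_Ioc]
  rfl

theorem eqOn_glueHalves_left (u v : ℝ → ℝ) :
    Set.EqOn (fun ω => u (2 * ω)) (glueHalves u v) (Set.uIoc 0 (1 / 2)) := by
  intro ω hω
  rw [Set.uIoc_of_le (by norm_num)] at hω
  exact (if_pos hω.2).symm

theorem eqOn_glueHalves_right (u v : ℝ → ℝ) :
    Set.EqOn (fun ω => v (2 * ω - 1)) (glueHalves u v) (Set.uIoc (1 / 2) 1) := by
  intro ω hω
  rw [Set.uIoc_of_le (by norm_num)] at hω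
  exact (if_neg (not_le.mpr hω.1)).symm

theorem intervalIntegrable_glueHalves_left {u : ℝ → ℝ} (v : ℝ → ℝ) (hu : Integrable u μ01) :
    IntervalIntegrable (glueHalves u v) volume 0 (1 / 2) := by
  have h := (integrable_μ01_iff.mp hu).comp_mul_left (c := 2)
  rw [zero_div] at h
  exact h.congr (eqOn_glueHalves_left u v)

theorem intervalIntegrable_glueHalves_right (u : ℝ → ℝ) {v : ℝ → ℝ} (hv : Integrable v μ01) :
    IntervalIntegrable (glueHalves u v) volume (1 / 2) 1 := by
  have h := ((integrable_μ01_iff.mp hv).comp_sub_right 1).comp_mul_left (c := 2)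
  norm_num at h
  exact h.congr (eqOn_glueHalves_right u v)

theorem integrable_glueHalves {u v : ℝ → ℝ} (hu : Integrable u μ01) (hv : Integrable v μ01) :
    Integrable (glueHalves u v) μ01 :=
  integrable_μ01_iff.mpr <| (intervalIntegrable_glueHalves_left v hu).trans
    (intervalIntegrable_glueHalves_right u hv)

theorem integral_glueHalves {u v : ℝ → ℝ} (hu : Integrable u μ01) (hv : Integrable v μ01) :
    ∫ ω, glueHalves u v ω ∂μ01 = ∫ ω, (u ω + v ω) / 2 ∂μ01 := by
  have hleft : ∫ ω in (0 : ℝ)..1 / 2, glueHalves u v ω = 2⁻¹ * ∫ ω in (0 : ℝ)..1, u ω := by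
    rw [← intervalIntegral.integral_congr_ae (.of_forall (eqOn_glueHalves_left u v)),
      intervalIntegral.integral_comp_mul_left u two_ne_zero]
    norm_num
  have hright : ∫ ω in (1 / 2 : ℝ)..1, glueHalves u v ω = 2⁻¹ * ∫ ω in (0 : ℝ)..1, v ω := by
    rw [← intervalIntegral.integral_congr_ae (.of_forall (eqOn_glueHalves_right u v)),
      intervalIntegral.integral_comp_mul_sub v two_ne_zero]
    norm_num
  rw [integral_div, integral_add hu hv, integral_μ01_eq, integral_μ01_eq, integral_μ01_eq,
    ← intervalIntegral.integral_add_adjacent_intervals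
      (intervalIntegrable_glueHalves_left v hu) (intervalIntegrable_glueHalves_right u hv),
    hleft, hright]
  ring

theorem alspachF_eq_glueHalves (f : ℝ → ℝ) :
    alspachF f = glueHalves (fun ω => min 2 (2 * f ω)) (fun ω => max 0 (2 * f ω - 2)) :=
  rfl

theorem ae_comp_two_mul {p : ℝ → Prop} (hp : ∀ᵐ ω, p ω) : ∀ᵐ ω : ℝ, p (2 * ω) := by
  have h : Measure.QuasiMeasurePreserving (fun ω : ℝ => 2 * ω) volume volume := by
    refine ⟨by fun_prop, ?_⟩
    rw [Real.map_volume_mul_left two_ne_zero]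
    exact Measure.smul_absolutelyContinuous
  exact h.ae hp

theorem alspachF_mem_Icc {f : ℝ → ℝ} (hf : ∀ᵐ ω ∂μ01, 0 ≤ f ω ∧ f ω ≤ 2) :
    ∀ᵐ ω ∂μ01, 0 ≤ alspachF f ω ∧ alspachF f ω ≤ 2 := by
  rw [μ01, ae_restrict_iff' measurableSet_Icc] at hf ⊢
  have hshift : ∀ᵐ ω : ℝ, ω - 1 ∈ Set.Icc (0 : ℝ) 1 → 0 ≤ f (ω - 1) ∧ f (ω - 1) ≤ 2 :=
    (measurePreserving_sub_right volume (1 : ℝ)).quasiMeasurePreserving.ae hf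
  filter_upwards [ae_comp_two_mul hf, ae_comp_two_mul hshift] with ω hleft hright hω
  unfold alspachF
  split_ifs with h
  · have := hleft ⟨by linarith [hω.1], by linarith⟩
    exact ⟨le_min zero_le_two (by linarith), min_le_left _ _⟩
  · have := hright ⟨by linarith, by linarith [hω.2]⟩
    exact ⟨le_max_left _ _, max_le zero_le_two (by linarith)⟩

instance : IsFiniteMeasure μ01 := by
  unfold μ01
  infer_instance

theorem integrable_min_two {f : ℝ → ℝ} (hf : Integrable f μ01) :
    Integrable (fun ω => min 2 (2 * f ω)) μ01 :=
  (integrable_const 2).inf (hf.const_mul 2)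

theorem integrable_max_zero {f : ℝ → ℝ} (hf : Integrable f μ01) :
    Integrable (fun ω => max 0 (2 * f ω - 2)) μ01 :=
  (integrable_const 0).sup ((hf.const_mul 2).sub (integrable_const 2))

theorem min_two_add_max_zero (a : ℝ) : (min 2 (2 * a) + max 0 (2 * a - 2)) / 2 = a := by
  grind

theorem abs_min_two_sub_add_abs_max_zero_sub (a b : ℝ) :
    (|min 2 (2 * a) - min 2 (2 * b)| + |max 0 (2 * a - 2) - max 0 (2 * b - 2)|) / 2
      = |a - b| := by
  grind

theorem memK_alspachF {f : ℝ → ℝ} (hf : memK f) : memK (alspachF f) := by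
  obtain ⟨hint, hbound, hmean⟩ := hf
  have hmin := integrable_min_two hint
  have hmax := integrable_max_zero hint
  refine ⟨integrable_glueHalves hmin hmax, alspachF_mem_Icc hbound, ?_⟩
  rw [alspachF_eq_glueHalves, integral_glueHalves hmin hmax, ← hmean]
  simp only [min_two_add_max_zero]

theorem integral_abs_alspachF_sub {f g : ℝ → ℝ} (hf : Integrable f μ01)
    (hg : Integrable g μ01) :
    ∫ ω, |alspachF f ω - alspachF g ω| ∂μ01 = ∫ ω, |f ω - g ω| ∂μ01 := by
  have hglue : (fun ω => |alspachF f ω - alspachF g ω|) =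
      glueHalves (fun ω => |min 2 (2 * f ω) - min 2 (2 * g ω)|)
        (fun ω => |max 0 (2 * f ω - 2) - max 0 (2 * g ω - 2)|) := by
    funext ω
    unfold alspachF glueHalves
    split_ifs <;> rfl
  rw [hglue]
  refine (integral_glueHalves ((integrable_min_two hf).sub (integrable_min_two hg)).abs
    ((integrable_max_zero hf).sub (integrable_max_zero hg)).abs).trans ?_
  simp only [Pi.sub_apply, abs_min_two_sub_add_abs_max_zero_sub]

/-- Alspach's map `F` maps `K` into `K` and is an isometry on `K` for the `L₁`-metric. -/
theorem alspachF_maps_K_to_K_and_is_isometry :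
    (∀ f : ℝ → ℝ, memK f → memK (alspachF f)) ∧
    ∀ f g : ℝ → ℝ, memK f → memK g →
      ∫ ω, |alspachF f ω - alspachF g ω| ∂μ01 = ∫ ω, |f ω - g ω| ∂μ01 := by
  exact ⟨fun _ hf => memK_alspachF hf,
    fun _ _ hf hg => integral_abs_alspachF_sub hf.1 hg.1⟩
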